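/- (Margulis's discovery.) There exists an injective group homomorphism ρ from the free group of rank two into the group Aff(ℝ³) of affine transformations of ℝ³ such that the induced action of the free group on ℝ³ is free and properly discontinuous. In particular, a nonabelian free group admits a proper affine action on three-dimensional affine space. -/

import Mathlib

/-! Binary quadratic forms `X = (p, q, r)` on `ℝ²`; the group acts through `SL(2,ℝ)`, twisted by a
cocycle.  Properness comes from a ping-pong estimate of the pairing `P X a b / W a b`. -/

namespace MargulisProof

/-- polar form of the binary quadratic form `X` -/
noncomputable def P (X : Fin 3 → ℝ) (a b : ℝ × ℝ) : ℝ :=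
  X 0 * (a.1 * b.1) + X 1 * (a.1 * b.2 + a.2 * b.1) + X 2 * (a.2 * b.2)

/-- area form -/
noncomputable def W (a b : ℝ × ℝ) : ℝ := a.1 * b.2 - a.2 * b.1

noncomputable def DA : (Fin 3 → ℝ) ≃ₗ[ℝ] (Fin 3 → ℝ) where
  toFun X := ![X 0 / 16, X 1, X 2 * 16]
  invFun X := ![X 0 * 16, X 1, X 2 / 16]
  map_add' X Y := by ext i; fin_cases i <;> simp <;> ring
  map_smul' c X := by ext i; fin_cases i <;> simp <;> ring
  left_inv X := by ext i; fin_cases i <;> simp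
  right_inv X := by ext i; fin_cases i <;> simp

noncomputable def DB : (Fin 3 → ℝ) ≃ₗ[ℝ] (Fin 3 → ℝ) where
  toFun X := ![(289 * X 0 - 510 * X 1 + 225 * X 2) / 64,
    (-255 * X 0 + 514 * X 1 - 255 * X 2) / 64, (225 * X 0 - 510 * X 1 + 289 * X 2) / 64]
  invFun X := ![(289 * X 0 + 510 * X 1 + 225 * X 2) / 64,
    (255 * X 0 + 514 * X 1 + 255 * X 2) / 64, (225 * X 0 + 510 * X 1 + 289 * X 2) / 64]
  map_add' X Y := by ext i; fin_cases i <;> simp <;> ring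
  map_smul' c X := by ext i; fin_cases i <;> simp <;> ring
  left_inv X := by ext i; fin_cases i <;> simp <;> ring
  right_inv X := by ext i; fin_cases i <;> simp <;> ring

noncomputable def T (i : Fin 2) : (Fin 3 → ℝ) ≃ᵃ[ℝ] (Fin 3 → ℝ) :=
  if i = 0 then AffineEquiv.constVAdd ℝ (Fin 3 → ℝ) ![0, 1, 0] * DA.toAffineEquiv
  else AffineEquiv.constVAdd ℝ (Fin 3 → ℝ) ![-1, 0, 1] * DB.toAffineEquiv

noncomputable def TL (l : Fin 2 × Bool) : (Fin 3 → ℝ) ≃ᵃ[ℝ] (Fin 3 → ℝ) :=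
  cond l.2 (T l.1) (T l.1)⁻¹

/-- the letters acting on `ℝ²` -/
noncomputable def g : Fin 2 × Bool → ℝ × ℝ → ℝ × ℝ
  | (0, true), a => (4 * a.1, a.2 / 4)
  | (0, false), a => (a.1 / 4, 4 * a.2)
  | (1, true), a => ((17 * a.1 + 15 * a.2) / 8, (15 * a.1 + 17 * a.2) / 8)
  | (1, false), a => ((17 * a.1 - 15 * a.2) / 8, (-15 * a.1 + 17 * a.2) / 8)

/-- translational parts -/
noncomputable def u : Fin 2 × Bool → Fin 3 → ℝ
  | (0, true) => ![0, 1, 0]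
  | (0, false) => ![0, -1, 0]
  | (1, true) => ![-1, 0, 1]
  | (1, false) => ![1, 0, -1]

/-- coordinates adapted to a letter -/
noncomputable def co : Fin 2 × Bool → ℝ × ℝ → ℝ × ℝ
  | (0, true), a => a
  | (0, false), a => (a.2, a.1)
  | (1, true), a => (a.1 + a.2, a.1 - a.2)
  | (1, false), a => (a.1 - a.2, a.1 + a.2)

/-- attracting cone -/
def I (l : Fin 2 × Bool) (a : ℝ × ℝ) : Prop := 4 * |(co l a).2| ≤ |(co l a).1| ∧ (co l a).1 ≠ 0

/-- exterior cone -/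
def E (l : Fin 2 × Bool) (a : ℝ × ℝ) : Prop := |(co l a).1| ≤ 3 * |(co l a).2| ∧ (co l a).2 ≠ 0

/-- inverse letter -/
def iv (l : Fin 2 × Bool) : Fin 2 × Bool := (l.1, !l.2)

noncomputable def o : ℝ × ℝ := (2, 1)

lemma E_o (l) : E l o := by
  obtain ⟨i, b⟩ := l
  fin_cases i <;> cases b <;> norm_num [E, co, o]

lemma I_E {l m : Fin 2 × Bool} (h : l ≠ m) {a} (ha : I l a) : E m a := by
  obtain ⟨i, b⟩ := l
  obtain ⟨j, c⟩ := m
  obtain ⟨x, y⟩ := a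
  obtain ⟨h1, h2⟩ := ha
  have h3 := abs_pos.2 h2
  unfold E
  rw [← abs_pos]
  fin_cases i <;> cases b <;> fin_cases j <;> cases c <;> simp [co] at h h1 h2 h3 ⊢ <;>
    constructor <;> grind

lemma E_I {l a} (ha : E (iv l) a) : I l (g l a) := by
  obtain ⟨i, b⟩ := l
  obtain ⟨x, y⟩ := a
  obtain ⟨h1, h2⟩ := ha
  have h3 := abs_pos.2 h2
  unfold I
  rw [← abs_pos]
  fin_cases i <;> cases b <;> simp [co, iv, g] at h1 h2 h3 ⊢ <;>
    constructor <;> grind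

lemma key {x1 x2 y1 y2 : ℝ} (h1 : 4 * |x2| ≤ |x1|) (h2 : x1 ≠ 0) (h3 : |y1| ≤ 3 * |y2|)
    (h4 : y2 ≠ 0) : 1 / 7 ≤ (x1 * y2 + x2 * y1) / (x1 * y2 - x2 * y1) := by
  have h5 : |x2 * y1| * 4 ≤ 3 * |x1 * y2| := by
    rw [abs_mul, abs_mul]
    nlinarith [mul_le_mul h1 h3 (abs_nonneg _) (abs_nonneg _)]
  have h6 : 0 < |x1 * y2| := by positivity
  generalize x1 * y2 = s at *
  generalize x2 * y1 = t at *
  rcases lt_or_gt_of_ne (abs_pos.1 h6) with h | h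
  · have hp : 0 < -(s - t) := by clear h1 h2 h3 h4; grind
    rw [← neg_div_neg_eq (s + t), div_le_div_iff₀ (by norm_num) hp]
    clear h1 h2 h3 h4; grind
  · have hp : 0 < s - t := by clear h1 h2 h3 h4; grind
    rw [div_le_div_iff₀ (by norm_num) hp]
    clear h1 h2 h3 h4; grind

lemma main_pos {l a b} (ha : I l a) (hb : E l b) : 1 / 7 ≤ P (u l) a b / W a b := by
  have := key ha.1 ha.2 hb.1 hb.2
  obtain ⟨i, c⟩ := l
  refine this.trans (le_of_eq ?_)
  fin_cases i <;> cases c <;> simp [co, P, W, u]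
  · rw [← neg_div_neg_eq]; congr 1 <;> ring
  · rw [← mul_div_mul_left _ _ (show (1/2:ℝ) ≠ 0 by norm_num)]; congr 1 <;> ring
  · rw [← mul_div_mul_left _ _ (show (-1/2:ℝ) ≠ 0 by norm_num)]; congr 1 <;> ring

lemma W_g (l a b) : W (g l a) b = W a (g (iv l) b) := by
  obtain ⟨i, c⟩ := l
  fin_cases i <;> cases c <;> simp [W, g, iv] <;> ring

lemma TL_A (Y) : TL (0, true) Y = ![0, 1, 0] + DA Y := rfl
lemma TL_B (Y) : TL (1, true) Y = ![-1, 0, 1] + DB Y := rfl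
lemma TL_a (Y) : TL (0, false) Y = DA.symm (-![0, 1, 0] + Y) := rfl
lemma TL_b (Y) : TL (1, false) Y = DB.symm (-![-1, 0, 1] + Y) := rfl

lemma P_g (l a b Y) : P (TL l Y) (g l a) b = P Y a (g (iv l) b) + P (u l) (g l a) b := by
  obtain ⟨i, c⟩ := l
  fin_cases i <;> cases c <;>
    simp [P, g, iv, u, DA, DB, TL_A, TL_B, TL_a, TL_b, Matrix.vecHead, Matrix.vecTail] <;> ring

noncomputable def gL (L : List (Fin 2 × Bool)) (a : ℝ × ℝ) : ℝ × ℝ := L.foldr g a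

lemma gL_I (L : List (Fin 2 × Bool)) : ∀ l, FreeGroup.IsReduced (l :: L) → I l (gL (l :: L) o) := by
  induction L with
  | nil => intro l _; exact E_I (E_o _)
  | cons m L ih =>
    intro l h
    rw [FreeGroup.isReduced_cons_cons] at h
    refine E_I (I_E ?_ (ih m h.2))
    rintro rfl
    simpa [iv] using h.1

lemma growth (L : List (Fin 2 × Bool)) : ∀ l b X, FreeGroup.IsReduced (l :: L) → E l b →
    ∃ m b', I m b' ∧ P X o b' / W o b' + (L.length + 1) / 7 ≤
      P ((((l :: L).map TL).prod) X) (gL (l :: L) o) b / W (gL (l :: L) o) b := by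
  induction L with
  | nil =>
    intro l b X h hb
    refine ⟨iv l, g (iv l) b, E_I (by simpa [iv] using hb), ?_⟩
    have h1 := main_pos (gL_I [] l h) hb
    simp only [gL, List.foldr, List.map, List.prod_cons, List.prod_nil, mul_one] at *
    rw [P_g, add_div (P _ _ _), ← W_g]
    simp only [List.length_nil]
    push_cast
    linarith
  | cons m L ih =>
    intro l b X h hb
    have h' := h
    rw [FreeGroup.isReduced_cons_cons] at h
    have hb' : E m (g (iv l) b) := by
      refine I_E ?_ (E_I (l := iv l) (by simpa [iv] using hb))
      rintro rfl
      simpa [iv] using h.1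
    obtain ⟨n, b', hn, hle⟩ := ih m _ X h.2 hb'
    refine ⟨n, b', hn, ?_⟩
    have h1 := main_pos (gL_I (m :: L) l h') hb
    rw [List.map_cons, List.prod_cons, AffineEquiv.mul_def, AffineEquiv.trans_apply]
    change _ ≤ P (TL l _) (g l (gL (m :: L) o)) b / W (g l (gL (m :: L) o)) b
    change _ ≤ P (u l) (g l (gL (m :: L) o)) b / W (g l (gL (m :: L) o)) b at h1
    rw [P_g, add_div (P _ _ _)]
    rw [← W_g] at hle
    simp only [List.length_cons]
    push_cast
    linarith

lemma W_o {l a} (ha : I l a) : |a.1| ≤ 10 * |W a o| ∧ |a.2| ≤ 10 * |W a o| ∧ 0 < |W a o| := by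
  obtain ⟨i, b⟩ := l
  obtain ⟨x, y⟩ := a
  obtain ⟨h1, h2⟩ := ha
  fin_cases i <;> cases b <;> simp [co, W, o, -abs_pos] at h1 h2 ⊢ <;>
    refine ⟨?_, ?_, ?_⟩ <;> grind

lemma P_comm (X a b) : P X a b = P X b a := by unfold P; ring
lemma W_comm (a b) : W a b = - W b a := by unfold W; ring

lemma bound {l a} (ha : I l a) (X : Fin 3 → ℝ) : |P X a o / W a o| ≤ 60 * ‖X‖ := by
  obtain ⟨h1, h2, h3⟩ := W_o ha
  rw [abs_div, div_le_iff₀ h3]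
  have hX : ∀ i, |X i| ≤ ‖X‖ := fun i => norm_le_pi_norm X i
  have e : P X a o = X 0 * (2 * a.1) + X 1 * (a.1 + 2 * a.2) + X 2 * a.2 := by
    simp only [P, o]; ring
  rw [e]
  have t1 : |2 * a.1| ≤ 20 * |W a o| := by rw [abs_mul]; norm_num; linarith
  have t2 : |a.1 + 2 * a.2| ≤ 30 * |W a o| := by
    refine (abs_add_le _ _).trans ?_
    rw [abs_mul]; norm_num; linarith
  have n := norm_nonneg X
  have m : ∀ {x y c : ℝ}, |x| ≤ ‖X‖ → |y| ≤ c → |x * y| ≤ ‖X‖ * c := by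
    intro x y c hx hy
    rw [abs_mul]
    exact mul_le_mul hx hy (abs_nonneg _) n
  have s1 := m (hX 0) t1
  have s2 := m (hX 1) t2
  have s3 := m (hX 2) h2
  refine (abs_add_three _ _ _).trans ?_
  linarith

lemma bound' {l a} (ha : I l a) (X : Fin 3 → ℝ) : |P X o a / W o a| ≤ 60 * ‖X‖ := by
  rw [P_comm, W_comm, div_neg, abs_neg]
  exact bound ha X

noncomputable def rho : FreeGroup (Fin 2) →* ((Fin 3 → ℝ) ≃ᵃ[ℝ] (Fin 3 → ℝ)) := FreeGroup.lift T

lemma length_le (w : FreeGroup (Fin 2)) (x : Fin 3 → ℝ) :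
    (w.toWord.length : ℝ) ≤ 420 * (‖x‖ + ‖rho w x‖) := by
  have hw : rho w = (w.toWord.map TL).prod := by
    conv_lhs => rw [← FreeGroup.mk_toWord (x := w)]
    rw [rho, FreeGroup.lift_mk]; rfl
  have hr : FreeGroup.IsReduced w.toWord := FreeGroup.isReduced_toWord
  rw [hw]
  generalize w.toWord = L at hr
  cases L with
  | nil => simp
  | cons l L =>
    obtain ⟨m, b', hm, hle⟩ := growth L l o x hr (E_o l)
    have h1 := abs_le.1 (bound' hm x)
    have h2 := abs_le.1 (bound (gL_I L l hr) (((l :: L).map TL).prod x))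
    simp only [List.length_cons]
    push_cast
    linarith [h1.1, h2.2]

lemma proper (K L : Set (Fin 3 → ℝ)) (hK : IsCompact K) (hL : IsCompact L) :
    {w : FreeGroup (Fin 2) | ∃ x ∈ K, rho w x ∈ L}.Finite := by
  obtain ⟨R, hR⟩ := hK.isBounded.exists_norm_le
  obtain ⟨S, hS⟩ := hL.isBounded.exists_norm_le
  obtain ⟨N, hN⟩ := exists_nat_ge (420 * (R + S))
  have hf : {M : List (Fin 2 × Bool) | M.length ≤ N}.Finite := List.finite_length_le _ _
  refine (hf.preimage (f := FreeGroup.toWord) FreeGroup.toWord_injective.injOn).subset ?_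
  rintro w ⟨x, hx, hy⟩
  have := length_le w x
  have h1 := hR x hx
  have h2 := hS _ hy
  simp only [Set.mem_preimage, Set.mem_ofPred_eq]
  have : (w.toWord.length : ℝ) ≤ N := by linarith
  exact_mod_cast this

lemma free (w : FreeGroup (Fin 2)) (x : Fin 3 → ℝ) (h : rho w x = x) : w = 1 := by
  by_contra hw
  have hp : ∀ n : ℕ, rho (w ^ n) x = x := by
    intro n
    induction n with
    | zero => simp
    | succ n ih =>
      rw [pow_succ, map_mul, AffineEquiv.mul_def, AffineEquiv.trans_apply, h, ih]
  have hinj : Function.Injective (fun n : ℕ => w ^ n) := injective_pow_iff_not_isOfFinOrder.2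
    (not_isOfFinOrder_of_isMulTorsionFree hw)
  refine Set.infinite_of_injective_forall_mem hinj (fun n => ?_)
    (proper {x} {x} isCompact_singleton isCompact_singleton)
  exact ⟨x, rfl, hp n⟩

end MargulisProof

/-- Margulis's discovery: there is an injective homomorphism from the free group
of rank two into the group `Aff(ℝ³)` of affine transformations of `ℝ³`
(formalized as affine self-equivalences of `ℝ³`) whose induced action on `ℝ³`
is free and properly discontinuous. -/
theorem margulis_proper_affine_action_of_free_group :
    ∃ ρ : FreeGroup (Fin 2) →* ((Fin 3 → ℝ) ≃ᵃ[ℝ] (Fin 3 → ℝ)),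
      Function.Injective ρ ∧
      (∀ (w : FreeGroup (Fin 2)) (x : Fin 3 → ℝ), ρ w x = x → w = 1) ∧
      (∀ K L : Set (Fin 3 → ℝ), IsCompact K → IsCompact L →
        {w : FreeGroup (Fin 2) | ∃ x ∈ K, ρ w x ∈ L}.Finite) := by
  refine ⟨MargulisProof.rho, ?_, MargulisProof.free, MargulisProof.proper⟩
  rw [injective_iff_map_eq_one]
  intro w hw
  exact MargulisProof.free w 0 (by rw [hw]; rfl)
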